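/- Let μ₁⁽¹⁾, μ₂⁽¹⁾ and μ₁⁽²⁾, μ₂⁽²⁾ be two pairs of reward models X × 𝒵 → [0,1], and for b ∈ {1,2} define the balanced mixture moments 𝐌⁽ᵇ⁾(x,z) := ½ Π_i μ₁⁽ᵇ⁾(x_i,z_i) + ½ Π_i μ₂⁽ᵇ⁾(x_i,z_i). Fix x = (x₁,x₂,x₃) and z = (z₁,z₂,z₃), and suppose that for every subset I ⊆ {1,2,3} with 1 ≤ |I| ≤ 2 one has |𝐌⁽¹⁾(x_I, z_I) − 𝐌⁽²⁾(x_I, z_I)| ≤ δ. Then the degree-three moments also nearly match: |𝐌⁽¹⁾(x, z) − 𝐌⁽²⁾(x, z)| ≤ 12δ. -/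

import Mathlib

open Finset

/-- The balanced two-component mixture moment
`𝐌(x_I, z_I) = ½ Π_{i∈I} μ₁(x_i, z_i) + ½ Π_{i∈I} μ₂(x_i, z_i)`. -/
noncomputable def balMoment {X Z : Type*} (μ₁ μ₂ : X → Z → ℝ) {d : ℕ}
    (x : Fin d → X) (z : Fin d → Z) (I : Finset (Fin d)) : ℝ :=
  (1 / 2) * ∏ i ∈ I, μ₁ (x i) (z i) + (1 / 2) * ∏ i ∈ I, μ₂ (x i) (z i)

/-- A product of numbers in `[0, 1]` is stable under perturbation of its factors. -/
theorem abs_mul_sub_mul_le_of_mem_Icc {a b a' b' ε η : ℝ} (ha : a ∈ Set.Icc (0 : ℝ) 1)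
    (hb' : b' ∈ Set.Icc (0 : ℝ) 1) (hε : |a - a'| ≤ ε) (hη : |b - b'| ≤ η) :
    |a * b - a' * b'| ≤ ε + η := by
  have h₁ : |(a - a') * b'| ≤ ε := by
    rw [abs_mul, abs_of_nonneg hb'.1]
    exact (mul_le_of_le_one_right (abs_nonneg _) hb'.2).trans hε
  have h₂ : |a * (b - b')| ≤ η := by
    rw [abs_mul, abs_of_nonneg ha.1]
    exact (mul_le_of_le_one_left (abs_nonneg _) ha.2).trans hη
  calc |a * b - a' * b'| = |(a - a') * b' + a * (b - b')| := by ring_nf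
    _ ≤ ε + η := (abs_add_le _ _).trans (add_le_add h₁ h₂)

theorem balMoment_mem_Icc {X Z : Type*} {μ₁ μ₂ : X → Z → ℝ}
    (h₁ : ∀ x z, μ₁ x z ∈ Set.Icc (0 : ℝ) 1) (h₂ : ∀ x z, μ₂ x z ∈ Set.Icc (0 : ℝ) 1)
    {d : ℕ} (x : Fin d → X) (z : Fin d → Z) (I : Finset (Fin d)) :
    balMoment μ₁ μ₂ x z I ∈ Set.Icc (0 : ℝ) 1 := by
  have p₁ := Finset.prod_nonneg fun i (_ : i ∈ I) => (h₁ (x i) (z i)).1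
  have p₂ := Finset.prod_nonneg fun i (_ : i ∈ I) => (h₂ (x i) (z i)).1
  have q₁ := Finset.prod_le_one (fun i (_ : i ∈ I) => (h₁ (x i) (z i)).1)
    fun i _ => (h₁ (x i) (z i)).2
  have q₂ := Finset.prod_le_one (fun i (_ : i ∈ I) => (h₂ (x i) (z i)).1)
    fun i _ => (h₂ (x i) (z i)).2
  unfold balMoment
  constructor <;> linarith

/-- The third central moment of a balanced two-component mixture vanishes, so its degree-three
moment is a polynomial in the moments of lower degree. -/
theorem balMoment_univ_three {X Z : Type*} (μ₁ μ₂ : X → Z → ℝ) (x : Fin 3 → X) (z : Fin 3 → Z) :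
    balMoment μ₁ μ₂ x z Finset.univ =
      balMoment μ₁ μ₂ x z {0} * balMoment μ₁ μ₂ x z {1, 2}
      + balMoment μ₁ μ₂ x z {1} * balMoment μ₁ μ₂ x z {0, 2}
      + balMoment μ₁ μ₂ x z {2} * balMoment μ₁ μ₂ x z {0, 1}
      - 2 * (balMoment μ₁ μ₂ x z {0} *
          (balMoment μ₁ μ₂ x z {1} * balMoment μ₁ μ₂ x z {2})) := by
  simp [balMoment, Fin.prod_univ_three]
  ring

/-- for balanced two-component mixtures, if all moments of degree 1 and 2
of a fixed length-three sequence match up to `δ`, then the degree-three moments match up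
to `12δ`. -/
theorem statement3 {X Z : Type*} (μ₁₁ μ₂₁ μ₁₂ μ₂₂ : X → Z → ℝ)
    (hμ₁₁ : ∀ x z, μ₁₁ x z ∈ Set.Icc (0 : ℝ) 1)
    (hμ₂₁ : ∀ x z, μ₂₁ x z ∈ Set.Icc (0 : ℝ) 1)
    (hμ₁₂ : ∀ x z, μ₁₂ x z ∈ Set.Icc (0 : ℝ) 1)
    (hμ₂₂ : ∀ x z, μ₂₂ x z ∈ Set.Icc (0 : ℝ) 1)
    (x : Fin 3 → X) (z : Fin 3 → Z) (δ : ℝ)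
    (hclose : ∀ I : Finset (Fin 3), 1 ≤ I.card → I.card ≤ 2 →
      |balMoment μ₁₁ μ₂₁ x z I - balMoment μ₁₂ μ₂₂ x z I| ≤ δ) :
    |balMoment μ₁₁ μ₂₁ x z Finset.univ - balMoment μ₁₂ μ₂₂ x z Finset.univ| ≤ 12 * δ := by
  have m₁ := balMoment_mem_Icc hμ₁₁ hμ₂₁ x z
  have m₂ := balMoment_mem_Icc hμ₁₂ hμ₂₂ x z
  have c₀ := hclose {0} (by decide) (by decide)
  have c₁ := hclose {1} (by decide) (by decide)
  have c₂ := hclose {2} (by decide) (by decide)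
  have e₀ := abs_mul_sub_mul_le_of_mem_Icc (m₁ {0}) (m₂ {1, 2}) c₀
    (hclose {1, 2} (by decide) (by decide))
  have e₁ := abs_mul_sub_mul_le_of_mem_Icc (m₁ {1}) (m₂ {0, 2}) c₁
    (hclose {0, 2} (by decide) (by decide))
  have e₂ := abs_mul_sub_mul_le_of_mem_Icc (m₁ {2}) (m₂ {0, 1}) c₂
    (hclose {0, 1} (by decide) (by decide))
  have e₃ := abs_mul_sub_mul_le_of_mem_Icc (m₁ {0}) (unitInterval.mul_mem (m₂ {1}) (m₂ {2})) c₀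
    (abs_mul_sub_mul_le_of_mem_Icc (m₁ {1}) (m₂ {2}) c₁ c₂)
  rw [balMoment_univ_three μ₁₁, balMoment_univ_three μ₁₂]
  rw [abs_le] at e₀ e₁ e₂ e₃ ⊢
  constructor <;> linarith [e₀.1, e₀.2, e₁.1, e₁.2, e₂.1, e₂.2, e₃.1, e₃.2]
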